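/- arXiv:1907.01057 — 2 statements merged into one kernel-verified Lean document; each statement's English description precedes it below -/
import Mathlib

section
/- Let η denote the Dedekind eta function. Then for all τ in the upper half plane, η(-1/τ) = (-iτ)^{1/2} · η(τ). -/
open Complex

/-- The Dedekind eta function `η(τ) = q^{1/24} ∏_{n≥1} (1 - qⁿ)`, `q = e^{2πiτ}`. -/
noncomputable def dedekindEta (τ : ℂ) : ℂ :=
  Complex.exp (Real.pi * Complex.I * τ / 12) *
    ∏' n : ℕ, (1 - Complex.exp (2 * Real.pi * Complex.I * τ) ^ (n + 1))

open UpperHalfPlane in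
theorem dedekindEta_eq_eta (z : ℂ) : dedekindEta z = ModularForm.eta z := by
  unfold dedekindEta ModularForm.eta
  simp only [ModularForm.eta_q_eq_pow, Function.Periodic.qParam]
  congr 2
  push_cast
  ring

theorem log_neg_I_mul (τ : ℂ) (hτ : 0 < τ.im) :
    Complex.log (-Complex.I * τ) = Complex.log τ - Complex.log Complex.I := by
  have h0 : τ ≠ 0 := by
    rintro rfl
    simp at hτ
  have h1 : 0 ≤ Complex.arg τ := Complex.arg_nonneg_iff.2 hτ.le
  have h2 : Complex.arg τ ≤ Real.pi := Complex.arg_le_pi τ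
  have hpi := Real.pi_pos
  rw [(Complex.log_mul_eq_add_log_iff (by simp) h0).2, Complex.log_neg_I, Complex.log_I]
  · ring
  · rw [Complex.arg_neg_I]
    constructor <;> linarith

/-- The eta transformation law: `η(-1/τ) = (-iτ)^{1/2} η(τ)` on the upper half plane,
with the principal branch of the square root. -/
theorem dedekindEta_neg_one_div (τ : ℂ) (hτ : 0 < τ.im) :
    dedekindEta (-1 / τ) = (-Complex.I * τ) ^ ((1 : ℂ) / 2) * dedekindEta τ := by
  have h0 : τ ≠ 0 := by
    rintro rfl
    simp at hτ
  have h := ModularForm.eta_comp_eq_csqrt_I_inv (show τ ∈ UpperHalfPlane.upperHalfPlaneSet from hτ)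
  simp only [Function.comp, Pi.smul_apply, Pi.mul_apply, smul_eq_mul] at h
  rw [dedekindEta_eq_eta, dedekindEta_eq_eta, h, Complex.sqrt, Complex.sqrt, Complex.cpow_def_of_ne_zero h0,
    Complex.cpow_def_of_ne_zero Complex.I_ne_zero, Complex.cpow_def_of_ne_zero (by simp [h0]),
    log_neg_I_mul τ hτ, ← Complex.exp_neg, ← mul_assoc, ← Complex.exp_add]
  congr 2
  ring
end

section
/- For every natural number n, p(11n+6) ≡ 0 (mod 11), where p is the partition function. -/
namespace PartitionEleven
open PowerSeries

/-- The coefficient field. -/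
abbrev K : Type := ZMod 11

instance fact_prime_eleven : Fact (Nat.Prime 11) := ⟨by norm_num⟩

/-- The `q`-Pochhammer symbol `(q;q)_m`. -/
noncomputable def poch (m : ℕ) : K⟦X⟧ := ∏ i ∈ Finset.range m, (1 - X ^ (i + 1))

lemma poch_succ (m : ℕ) : poch (m + 1) = poch m * (1 - X ^ (m + 1)) := by
  simp [poch, Finset.prod_range_succ]

lemma constantCoeff_poch (m : ℕ) : constantCoeff (poch m) = 1 := by
  simp [poch]

/-- The reciprocals of the `q`-Pochhammer symbols, shifted by one. -/
noncomputable def w : ℕ → K⟦X⟧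
  | 0 => 0
  | m + 1 => (poch m)⁻¹

lemma poch_mul_w (m : ℕ) : poch m * w (m + 1) = 1 := by
  rw [w]
  exact PowerSeries.mul_inv_cancel _ (by simp [constantCoeff_poch])

lemma w_eq (j : ℕ) : w j = (1 - X ^ j) * w (j + 1) := by
  cases j with
  | zero => simp [w]
  | succ m =>
    have h1 := poch_mul_w m
    have h2 := poch_mul_w (m + 1)
    rw [poch_succ] at h2
    calc w (m + 1) = w (m + 1) * (poch m * (1 - X ^ (m + 1)) * w (m + 1 + 1)) := by
          rw [h2, mul_one]
      _ = (poch m * w (m + 1)) * ((1 - X ^ (m + 1)) * w (m + 1 + 1)) := by ring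
      _ = _ := by rw [h1, one_mul]

/-- The Gaussian binomial `[2n+1; n-k]`. -/
noncomputable def u (n k : ℕ) : K⟦X⟧ := poch (2 * n + 1) * w (n + 1 - k) * w (n + k + 2)

lemma u_eq_zero {n k : ℕ} (h : n < k) : u n k = 0 := by
  have : n + 1 - k = 0 := by omega
  simp [u, this, w]

lemma u_of {n k i j : ℕ} (hi : n + 1 - k = i) (hj : n + k + 2 = j) :
    u n k = poch (2 * n + 1) * w i * w j := by
  subst hi hj; rfl

lemma u_succ_zero (n : ℕ) :
    u (n + 1) 0 = (1 + X ^ (n + 1) + X ^ (2 * n + 2)) * u n 0 + X ^ (n + 2) * u n 1 := by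
  rw [u_of (n := n + 1) (k := 0) (i := n + 2) (j := n + 3) (by omega) (by omega),
    u_of (n := n) (k := 0) (i := n + 1) (j := n + 2) (by omega) (by omega),
    u_of (n := n) (k := 1) (i := n) (j := n + 3) (by omega) (by omega),
    show 2 * (n + 1) + 1 = 2 * n + 1 + 1 + 1 by ring, poch_succ, poch_succ,
    w_eq n, w_eq (n + 1), w_eq (n + 2)]
  ring

lemma u_succ_succ (a k : ℕ) :
    u (k + a + 1) (k + 1) = (1 + X ^ (2 * (k + a) + 2)) * u (k + a) (k + 1)
      + X ^ (2 * k + a + 3) * u (k + a) (k + 2) + X ^ a * u (k + a) k := by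
  rw [u_of (n := k + a + 1) (k := k + 1) (i := a + 1) (j := 2 * k + a + 4) (by omega) (by omega),
    u_of (n := k + a) (k := k + 1) (i := a) (j := 2 * k + a + 3) (by omega) (by omega),
    u_of (n := k + a) (k := k + 2) (i := a - 1) (j := 2 * k + a + 4) (by omega) (by omega),
    u_of (n := k + a) (k := k) (i := a + 1) (j := 2 * k + a + 2) (by omega) (by omega),
    show 2 * (k + a + 1) + 1 = 2 * (k + a) + 1 + 1 + 1 by ring, poch_succ, poch_succ,
    w_eq (2 * k + a + 2), w_eq (2 * k + a + 3)]
  cases a with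
  | zero => simp only [w, Nat.zero_sub]; ring
  | succ b =>
    rw [show b + 1 - 1 = b by omega, w_eq b, w_eq (b + 1)]
    ring

/-- Triangular numbers. -/
def tri : ℕ → ℕ
  | 0 => 0
  | k + 1 => tri k + (k + 1)

/-- Terms of Jacobi's series. -/
noncomputable def c (k : ℕ) : K⟦X⟧ := (-1) ^ k * (2 * (k : K⟦X⟧) + 1) * X ^ tri k

lemma jacobi_partial (n m : ℕ) (hm : m ≤ n) :
    ∑ k ∈ Finset.range (m + 1), c k * u (n + 1) k =
      (1 - X ^ (n + 1)) ^ 2 * ∑ k ∈ Finset.range (m + 1), c k * u n k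
      + (X ^ (n + 2 + m) * c m * u n (m + 1) - X ^ (n - m) * c (m + 1) * u n m) := by
  induction m with
  | zero =>
    simp only [zero_add, Finset.sum_range_one, u_succ_zero, c, tri, Nat.sub_zero]
    push_cast
    ring_nf
  | succ m ih =>
    rw [Finset.sum_range_succ, ih (by omega), Finset.sum_range_succ _ (m + 1), mul_add]
    obtain ⟨a, rfl⟩ := Nat.exists_eq_add_of_le hm
    rw [show m + 1 + a + 1 = m + (a + 1) + 1 by ring, u_succ_succ,
      show m + 1 + a - m = a + 1 by omega, show m + 1 + a - (m + 1) = a by omega,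
      show m + (a + 1) = m + 1 + a by ring]
    simp only [c, tri]
    push_cast
    ring_nf

lemma jacobi_finite (n : ℕ) :
    ∑ k ∈ Finset.range (n + 1), c k * u n k = poch n ^ 2 := by
  induction n with
  | zero =>
    have h : u 0 0 = 1 := by
      rw [u_of (i := 1) (j := 2) rfl rfl, mul_right_comm, poch_mul_w]
      have := poch_mul_w 0
      simp only [poch, Finset.range_zero, Finset.prod_empty, one_mul] at this
      simpa using this
    simp [h, c, tri, poch]
  | succ n ih =>
    have h := jacobi_partial n n le_rfl
    rw [Finset.sum_range_succ, h, ih, poch_succ, u_eq_zero (n := n) (k := n + 1) (by omega),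
      u_of (n := n + 1) (k := n + 1) (i := 1) (j := 2 * n + 1 + 1 + 1 + 1) (by omega) (by omega),
      u_of (n := n) (k := n) (i := 1) (j := 2 * n + 1 + 1) (by omega) (by omega),
      show 2 * (n + 1) + 1 = 2 * n + 1 + 1 + 1 by ring,
      mul_right_comm (poch (2 * n + 1)), mul_right_comm (poch (2 * n + 1 + 1 + 1)), poch_mul_w,
      poch_mul_w]
    simp
    ring

/-- Euler's product. -/
noncomputable def E : K⟦X⟧ := pentagonalSeries K

lemma dvd_prod_sub_one (m : ℕ) (s : Finset ℕ) (hs : ∀ i ∈ s, m ≤ i) :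
    (X : K⟦X⟧) ^ (m + 1) ∣ ∏ i ∈ s, (1 - X ^ (i + 1)) - 1 := by
  induction s using Finset.induction_on with
  | empty => simp
  | insert a s ha ih =>
    rw [Finset.prod_insert ha]
    have h1 := ih fun i hi => hs i (Finset.mem_insert_of_mem hi)
    have h2 : (X : K⟦X⟧) ^ (m + 1) ∣ X ^ (a + 1) :=
      pow_dvd_pow _ (by have := hs a (Finset.mem_insert_self _ _); omega)
    have : (1 - X ^ (a + 1)) * ∏ i ∈ s, (1 - X ^ (i + 1) : K⟦X⟧) - 1 =
      (∏ i ∈ s, (1 - X ^ (i + 1) : K⟦X⟧) - 1)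
        - X ^ (a + 1) * ∏ i ∈ s, (1 - X ^ (i + 1) : K⟦X⟧) := by ring
    rw [this]
    exact dvd_sub h1 (h2.mul_right _)

lemma dvd_E_sub_poch (m : ℕ) : (X : K⟦X⟧) ^ (m + 1) ∣ E - poch m := by
  rw [X_pow_dvd_iff]
  intro d hd
  obtain ⟨s0, hs0⟩ := Filter.eventually_atTop.mp (coeff_prod_one_sub_X_pow_eventually_eq K d)
  have h := hs0 (s0 ∪ Finset.range m) Finset.subset_union_left
  have h2 : (X : K⟦X⟧) ^ (m + 1) ∣ ∏ i ∈ s0 ∪ Finset.range m, (1 - X ^ (i + 1)) - poch m := by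
    rw [← Finset.sdiff_union_self_eq_union, Finset.prod_union Finset.sdiff_disjoint]
    have := dvd_prod_sub_one m (s0 \ Finset.range m) (by simp)
    have := this.mul_right (poch m)
    rwa [sub_mul, one_mul] at this
  rw [X_pow_dvd_iff] at h2
  have h3 := h2 d hd
  rw [map_sub] at h3 ⊢
  rw [E, ← h, h3]

lemma dvd_E_mul_w_sub_one (m : ℕ) : (X : K⟦X⟧) ^ (m + 1) ∣ E * w (m + 1) - 1 := by
  have := (dvd_E_sub_poch m).mul_right (w (m + 1))
  rwa [sub_mul, poch_mul_w] at this

lemma dvd_u_mul_E_sub_one (k a : ℕ) : (X : K⟦X⟧) ^ (a + 1) ∣ u (k + a) k * E - 1 := by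
  rw [u_of (i := a + 1) (j := 2 * k + a + 1 + 1) (by omega) (by omega)]
  have h1 := dvd_E_mul_w_sub_one a
  have h2 : (X : K⟦X⟧) ^ (a + 1) ∣ E * w (2 * k + a + 1 + 1) - 1 :=
    (pow_dvd_pow _ (by omega)).trans (dvd_E_mul_w_sub_one (2 * k + a + 1))
  have h3 : (X : K⟦X⟧) ^ (a + 1) ∣ E - poch (2 * (k + a) + 1) :=
    (pow_dvd_pow _ (by omega)).trans (dvd_E_sub_poch _)
  have : poch (2 * (k + a) + 1) * w (a + 1) * w (2 * k + a + 1 + 1) * E - 1 =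
    (E * w (2 * k + a + 1 + 1) - 1) * (E * w (a + 1)) + (E * w (a + 1) - 1)
     - (E - poch (2 * (k + a) + 1)) * (w (a + 1) * w (2 * k + a + 1 + 1) * E) := by ring
  rw [this]
  exact dvd_sub (dvd_add (h2.mul_right _) h1) (h3.mul_right _)

lemma le_tri (k : ℕ) : k ≤ tri k := by
  induction k with
  | zero => simp [tri]
  | succ k ih => simp [tri]

lemma dvd_E_cube (n : ℕ) :
    (X : K⟦X⟧) ^ (n + 1) ∣ E ^ 3 - ∑ k ∈ Finset.range (n + 1), c k := by
  have h1 : (X : K⟦X⟧) ^ (n + 1) ∣ poch n ^ 2 * E - ∑ k ∈ Finset.range (n + 1), c k := by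
    rw [← jacobi_finite, Finset.sum_mul, ← Finset.sum_sub_distrib]
    refine Finset.dvd_sum fun k hk => ?_
    obtain ⟨a, rfl⟩ := Nat.exists_eq_add_of_le (Finset.mem_range_succ_iff.mp hk)
    have h := dvd_u_mul_E_sub_one k a
    have h2 : (X : K⟦X⟧) ^ k ∣ c k := (pow_dvd_pow _ (le_tri k)).mul_left _
    have := mul_dvd_mul h2 h
    rw [← pow_add] at this
    convert this using 1 <;> ring
  have h2 := (dvd_E_sub_poch n).mul_right ((E + poch n) * E)
  convert dvd_add h1 h2 using 1
  ring

lemma tri_cast (k : ℕ) : 8 * (tri k : K) + 1 = (2 * k + 1) ^ 2 := by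
  induction k with
  | zero => simp [tri]
  | succ k ih =>
    simp only [tri]
    push_cast
    linear_combination ih

lemma coeff_E_cube (n : ℕ)
    (hn : (n : K) = 2 ∨ (n : K) = 4 ∨ (n : K) = 5 ∨ (n : K) = 7 ∨ (n : K) = 8 ∨ (n : K) = 9) :
    coeff n (E ^ 3) = 0 := by
  have h := X_pow_dvd_iff.mp (dvd_E_cube n) n (by omega)
  rw [map_sub, sub_eq_zero] at h
  rw [h, map_sum]
  refine Finset.sum_eq_zero fun k _ => ?_
  have hc : c k = C ((-1) ^ k * (2 * (k : K) + 1)) * X ^ tri k := by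
    simp [c, show (C (2 : K)) = 2 from map_ofNat C 2]
  rw [hc, coeff_C_mul, coeff_X_pow]
  split_ifs with h
  · have h1 := tri_cast k
    rw [← h] at h1
    have : (2 * (k : K) + 1) = 0 := by
      clear hc h
      generalize 2 * (k : K) + 1 = y at *
      generalize (n : K) = z at *
      revert y z; decide
    simp [this]
  · simp


/-- Projection onto exponents in a residue class modulo `11`. -/
noncomputable def proj (r : K) (f : K⟦X⟧) : K⟦X⟧ :=
  PowerSeries.mk fun n => if (n : K) = r then coeff n f else 0

lemma coeff_proj (r : K) (f : K⟦X⟧) (n : ℕ) :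
    coeff n (proj r f) = if (n : K) = r then coeff n f else 0 := by
  simp [proj]

lemma proj_mul (r : K) (f g : K⟦X⟧) :
    proj r (f * g) = ∑ s : K, proj s f * proj (r - s) g := by
  ext n
  simp only [coeff_proj, map_sum, coeff_mul]
  rw [Finset.sum_comm]
  split_ifs with h
  · refine Finset.sum_congr rfl fun x hx => ?_
    rw [Finset.sum_eq_single (x.1 : K)]
    · rw [if_pos rfl, if_pos]
      rw [← h, ← Finset.HasAntidiagonal.mem_antidiagonal.mp hx]; push_cast; ring
    · intro b _ hb
      rw [if_neg (Ne.symm hb), zero_mul]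
    · simp
  · symm
    refine Finset.sum_eq_zero fun x hx => Finset.sum_eq_zero fun s _ => ?_
    by_cases h1 : (x.1 : K) = s
    · rw [if_neg (c := (x.2 : K) = r - s), mul_zero]
      intro h2
      apply h
      rw [← Finset.HasAntidiagonal.mem_antidiagonal.mp hx]; push_cast; rw [h1, h2]; ring
    · rw [if_neg h1, zero_mul]

lemma proj_pow_eleven {r : K} (hr : r ≠ 0) (f : K⟦X⟧) : proj r (f ^ 11) = 0 := by
  ext n
  rw [coeff_proj]
  split_ifs with h
  · have h1 : f ^ 11 = PowerSeries.map (frobenius K 11) (expand 11 (by norm_num) f) :=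
      (MvPowerSeries.map_frobenius_expand 11 (by norm_num)).symm
    rw [h1, coeff_map, coeff_expand_of_not_dvd, map_zero, map_zero]
    rw [← ZMod.natCast_eq_zero_iff, h]
    exact hr
  · simp

lemma proj_zero_pow_eleven (f : K⟦X⟧) : proj 0 (f ^ 11) = f ^ 11 := by
  ext n
  rw [coeff_proj]
  split_ifs with h
  · rfl
  · have := congrArg (coeff n) (proj_pow_eleven h f)
    rw [coeff_proj, if_pos rfl] at this
    rw [this, map_zero]

lemma proj_pow_eleven_mul (r : K) (f g : K⟦X⟧) : proj r (f ^ 11 * g) = f ^ 11 * proj r g := by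
  rw [proj_mul, Finset.sum_eq_single 0]
  · rw [proj_zero_pow_eleven, sub_zero]
  · intro s _ hs
    rw [proj_pow_eleven hs, zero_mul]
  · simp

lemma proj_E {r : K} (hr : r = 3 ∨ r = 6 ∨ r = 8 ∨ r = 9 ∨ r = 10) : proj r E = 0 := by
  ext n
  rw [coeff_proj]
  split_ifs with h
  · rw [E, coeff_pentagonalSeries_eq_zero, map_zero]
    rintro ⟨k, hk⟩
    have h1 := congrArg (Int.cast : ℤ → K) (two_mul_natCast_pentagonal k)
    push_cast at h1
    rw [hk, h] at h1
    clear h hk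
    generalize (k : K) = y at *
    revert y r; decide
  · simp

lemma proj_E_cube {r : K} (hr : r = 2 ∨ r = 4 ∨ r = 5 ∨ r = 7 ∨ r = 8 ∨ r = 9) :
    proj r (E ^ 3) = 0 := by
  ext n
  rw [coeff_proj]
  split_ifs with h
  · rw [coeff_E_cube n (by rw [h]; exact hr), map_zero]
  · simp

lemma proj_E_cube_pow_four {r : K} (hr : r = 3 ∨ r = 6 ∨ r = 8 ∨ r = 9 ∨ r = 10) :
    proj r ((E ^ 3) ^ 4) = 0 := by
  rw [show (E ^ 3) ^ 4 = E ^ 11 * E by ring, proj_pow_eleven_mul, proj_E hr, mul_zero]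

lemma sum_K (f : K → K⟦X⟧) : ∑ s : K, f s =
    f 0 + f 1 + f 2 + f 3 + f 4 + f 5 + f 6 + f 7 + f 8 + f 9 + f 10 := by
  have h : ∀ g : Fin 11 → K⟦X⟧, ∑ s, g s =
      g 0 + g 1 + g 2 + g 3 + g 4 + g 5 + g 6 + g 7 + g 8 + g 9 + g 10 := by
    intro g
    rw [Fin.sum_univ_castSucc, Fin.sum_univ_castSucc, Fin.sum_univ_castSucc, Fin.sum_univ_eight]
    rfl
  exact h f

lemma eleven_eq_zero : (11 : K⟦X⟧) = 0 := by
  have h : ((11 : ℕ) : K) = 0 := ZMod.natCast_self 11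
  have := congrArg (C : K →+* K⟦X⟧) h
  rw [map_zero, map_natCast] at this
  exact_mod_cast this

set_option linter.unusedSimpArgs false in
lemma proj_six_pow_seven (P : K⟦X⟧)
    (h2 : proj 2 P = 0) (h4 : proj 4 P = 0) (h5 : proj 5 P = 0)
    (h7 : proj 7 P = 0) (h8 : proj 8 P = 0) (h9 : proj 9 P = 0)
    (k3 : proj 3 (P ^ 4) = 0) (k6 : proj 6 (P ^ 4) = 0) (k8 : proj 8 (P ^ 4) = 0)
    (k9 : proj 9 (P ^ 4) = 0) (k10 : proj 10 (P ^ 4) = 0) :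
    proj 6 (P ^ 7) = 0 := by
  have e2 : ∀ r : K, proj r (P ^ 2) = proj 0 P * proj r P + proj 1 P * proj (r - 1) P
      + proj 3 P * proj (r - 3) P + proj 6 P * proj (r - 6) P + proj 10 P * proj (r - 10) P := by
    intro r
    rw [pow_two, proj_mul, sum_K, h2, h4, h5, h7, h8, h9]
    simp
  have e3 : ∀ r : K, proj r (P ^ 3) = proj 0 P * proj r (P ^ 2) + proj 1 P * proj (r - 1) (P ^ 2)
      + proj 3 P * proj (r - 3) (P ^ 2) + proj 6 P * proj (r - 6) (P ^ 2)
      + proj 10 P * proj (r - 10) (P ^ 2) := by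
    intro r
    rw [pow_succ' P 2, proj_mul, sum_K, h2, h4, h5, h7, h8, h9]
    simp
  have e4 : ∀ r : K, proj r (P ^ 4) = proj 0 P * proj r (P ^ 3) + proj 1 P * proj (r - 1) (P ^ 3)
      + proj 3 P * proj (r - 3) (P ^ 3) + proj 6 P * proj (r - 6) (P ^ 3)
      + proj 10 P * proj (r - 10) (P ^ 3) := by
    intro r
    rw [pow_succ' P 3, proj_mul, sum_K, h2, h4, h5, h7, h8, h9]
    simp
  have e7 : proj 6 (P ^ 7) = ∑ s : K, proj s (P ^ 4) * proj (6 - s) (P ^ 3) := by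
    rw [← proj_mul, ← pow_add]
  have s0_0 : (0 : K) - 0 = 0 := rfl
  have s0_1 : (0 : K) - 1 = 10 := rfl
  have s0_3 : (0 : K) - 3 = 8 := rfl
  have s0_6 : (0 : K) - 6 = 5 := rfl
  have s0_10 : (0 : K) - 10 = 1 := rfl
  have s1_0 : (1 : K) - 0 = 1 := rfl
  have s1_1 : (1 : K) - 1 = 0 := rfl
  have s1_3 : (1 : K) - 3 = 9 := rfl
  have s1_6 : (1 : K) - 6 = 6 := rfl
  have s1_10 : (1 : K) - 10 = 2 := rfl
  have s2_0 : (2 : K) - 0 = 2 := rfl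
  have s2_1 : (2 : K) - 1 = 1 := rfl
  have s2_3 : (2 : K) - 3 = 10 := rfl
  have s2_6 : (2 : K) - 6 = 7 := rfl
  have s2_10 : (2 : K) - 10 = 3 := rfl
  have s3_0 : (3 : K) - 0 = 3 := rfl
  have s3_1 : (3 : K) - 1 = 2 := rfl
  have s3_3 : (3 : K) - 3 = 0 := rfl
  have s3_6 : (3 : K) - 6 = 8 := rfl
  have s3_10 : (3 : K) - 10 = 4 := rfl
  have s4_0 : (4 : K) - 0 = 4 := rfl
  have s4_1 : (4 : K) - 1 = 3 := rfl
  have s4_3 : (4 : K) - 3 = 1 := rfl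
  have s4_6 : (4 : K) - 6 = 9 := rfl
  have s4_10 : (4 : K) - 10 = 5 := rfl
  have s5_0 : (5 : K) - 0 = 5 := rfl
  have s5_1 : (5 : K) - 1 = 4 := rfl
  have s5_3 : (5 : K) - 3 = 2 := rfl
  have s5_6 : (5 : K) - 6 = 10 := rfl
  have s5_10 : (5 : K) - 10 = 6 := rfl
  have s6_0 : (6 : K) - 0 = 6 := rfl
  have s6_1 : (6 : K) - 1 = 5 := rfl
  have s6_2 : (6 : K) - 2 = 4 := rfl
  have s6_3 : (6 : K) - 3 = 3 := rfl
  have s6_4 : (6 : K) - 4 = 2 := rfl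
  have s6_5 : (6 : K) - 5 = 1 := rfl
  have s6_6 : (6 : K) - 6 = 0 := rfl
  have s6_7 : (6 : K) - 7 = 10 := rfl
  have s6_8 : (6 : K) - 8 = 9 := rfl
  have s6_9 : (6 : K) - 9 = 8 := rfl
  have s6_10 : (6 : K) - 10 = 7 := rfl
  have s7_0 : (7 : K) - 0 = 7 := rfl
  have s7_1 : (7 : K) - 1 = 6 := rfl
  have s7_3 : (7 : K) - 3 = 4 := rfl
  have s7_6 : (7 : K) - 6 = 1 := rfl
  have s7_10 : (7 : K) - 10 = 8 := rfl
  have s8_0 : (8 : K) - 0 = 8 := rfl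
  have s8_1 : (8 : K) - 1 = 7 := rfl
  have s8_3 : (8 : K) - 3 = 5 := rfl
  have s8_6 : (8 : K) - 6 = 2 := rfl
  have s8_10 : (8 : K) - 10 = 9 := rfl
  have s9_0 : (9 : K) - 0 = 9 := rfl
  have s9_1 : (9 : K) - 1 = 8 := rfl
  have s9_3 : (9 : K) - 3 = 6 := rfl
  have s9_6 : (9 : K) - 6 = 3 := rfl
  have s9_10 : (9 : K) - 10 = 10 := rfl
  have s10_0 : (10 : K) - 0 = 10 := rfl
  have s10_1 : (10 : K) - 1 = 9 := rfl
  have s10_3 : (10 : K) - 3 = 7 := rfl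
  have s10_6 : (10 : K) - 6 = 4 := rfl
  have s10_10 : (10 : K) - 10 = 0 := rfl
  rw [sum_K] at e7
  rw [e7]
  simp only [s0_0, s0_1, s0_3, s0_6, s0_10, s1_0, s1_1, s1_3, s1_6, s1_10, s2_0, s2_1, s2_3, s2_6,
    s2_10, s3_0, s3_1, s3_3, s3_6, s3_10, s4_0, s4_1, s4_3, s4_6, s4_10, s5_0, s5_1, s5_3,
    s5_6, s5_10, s6_0, s6_1, s6_2, s6_3, s6_4, s6_5, s6_6, s6_7, s6_8, s6_9, s6_10, s7_0,
    s7_1, s7_3, s7_6, s7_10, s8_0, s8_1, s8_3, s8_6, s8_10, s9_0, s9_1, s9_3, s9_6, s9_10,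
    s10_0, s10_1, s10_3, s10_6, s10_10,
    e4, e3, e2, h2, h4, h5, h7, h8, h9, mul_zero, zero_mul, add_zero, zero_add] at k3 k6 k8 k9 k10 ⊢
  clear e7 e2 e3 e4
  generalize proj 0 P = a0 at *
  generalize proj 1 P = a1 at *
  generalize proj 3 P = a3 at *
  generalize proj 6 P = a6 at *
  generalize proj 10 P = a10 at *
  linear_combination ((4) * (a0 ^ 2 * a3) + (-1) * (a1 ^ 3) + (-1) * (a1 * a3 * a10)) * k3 +
    ((-1) * (a0 ^ 3) + (-1) * (a0 * a1 * a10) + (4) * (a6 ^ 2 * a10)) * k6 + ((-1) * (a0 * a3 *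
    a6) + (4) * (a0 * a10 ^ 2) + (-1) * (a3 ^ 3)) * k8 + ((4) * (a1 ^ 2 * a6) + (-1) * (a3 * a6
    * a10) + (-1) * (a10 ^ 3)) * k9 + ((-1) * (a0 * a1 * a6) + (4) * (a1 * a3 ^ 2) + (-1) * (a6
    ^ 3)) * k10 + (1 * (a0 ^ 6 * a6) + 1 * (a0 ^ 5 * a3 ^ 2) + 22 * (a0 ^ 4 * a1 * a6 * a10) +
    12 * (a0 ^ 3 * a1 ^ 3 * a3) + 30 * (a0 ^ 3 * a1 * a3 ^ 2 * a10) + 12 * (a0 ^ 3 * a6 ^ 3 *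
    a10) + 54 * (a0 ^ 2 * a1 ^ 2 * a3 * a6 ^ 2) + 54 * (a0 ^ 2 * a1 ^ 2 * a6 * a10 ^ 2) + 54 *
    (a0 ^ 2 * a3 ^ 2 * a6 ^ 2 * a10) + 30 * (a0 ^ 2 * a3 * a6 * a10 ^ 3) + 1 * (a0 ^ 2 * a10 ^
    5) + 1 * (a0 * a1 ^ 6) + 22 * (a0 * a1 ^ 4 * a3 * a10) + 30 * (a0 * a1 ^ 2 * a3 ^ 3 * a6) +
    54 * (a0 * a1 ^ 2 * a3 ^ 2 * a10 ^ 2) + 22 * (a0 * a1 * a3 * a6 ^ 4) + 30 * (a0 * a1 * a6 ^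
    3 * a10 ^ 2) + 22 * (a0 * a3 ^ 4 * a6 * a10) + 12 * (a0 * a3 ^ 3 * a10 ^ 3) + 1 * (a1 ^ 5 *
    a6 ^ 2) + 30 * (a1 ^ 3 * a3 * a6 ^ 2 * a10) + 12 * (a1 ^ 3 * a6 * a10 ^ 3) + 1 * (a1 ^ 2 *
    a3 ^ 5) + 12 * (a1 * a3 ^ 3 * a6 ^ 3) + 54 * (a1 * a3 ^ 2 * a6 ^ 2 * a10 ^ 2) + 22 * (a1 *
    a3 * a6 * a10 ^ 4) + 1 * (a1 * a10 ^ 6) + 1 * (a3 ^ 6 * a10) + 1 * (a3 * a6 ^ 6) + 1 * (a6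
    ^ 5 * a10 ^ 2)) * eleven_eq_zero

/-- The generating function of the partition numbers. -/
noncomputable def partGen : K⟦X⟧ :=
  PowerSeries.mk fun n => (Fintype.card (Nat.Partition n) : K)

open PowerSeries.WithPiTopology in
lemma partGen_mul_E : partGen * E = 1 := by
  let _ : TopologicalSpace K := ⊥
  have _ : DiscreteTopology K := ⟨rfl⟩
  have h1 := Nat.Partition.hasProd_powerSeriesMk_card_restricted K (fun _ => True)
  have h2 := h1.mul (hasProd_one_sub_X_pow K)
  have h3 : PowerSeries.mk (fun n => ((Nat.Partition.restricted n (fun _ => True)).card : K))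
      = partGen := by
    ext n
    simp [partGen, Nat.Partition.restricted, Finset.card_univ]
  rw [h3] at h2
  refine h2.unique ?_
  have h4 : (fun b : ℕ => (if True then ∑' j : ℕ, (X : K⟦X⟧) ^ ((b + 1) * j) else 1)
      * (1 - X ^ (b + 1))) = fun _ => 1 := by
    funext b
    simp only [if_true, pow_mul]
    exact tsum_pow_mul_one_sub_of_constantCoeff_eq_zero (by simp)
  rw [h4]
  exact hasProd_one

lemma E_ne_zero : E ≠ 0 := by
  intro h
  have := partGen_mul_E
  rw [h, mul_zero] at this
  exact zero_ne_one this

lemma proj_partGen : proj 6 partGen = 0 := by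
  have h1 : proj 6 ((E ^ 3) ^ 7) = 0 :=
    proj_six_pow_seven (E ^ 3) (proj_E_cube (by decide)) (proj_E_cube (by decide))
      (proj_E_cube (by decide)) (proj_E_cube (by decide)) (proj_E_cube (by decide))
      (proj_E_cube (by decide)) (proj_E_cube_pow_four (by decide))
      (proj_E_cube_pow_four (by decide)) (proj_E_cube_pow_four (by decide))
      (proj_E_cube_pow_four (by decide)) (proj_E_cube_pow_four (by decide))
  have h2 : (E ^ 3) ^ 7 = E ^ 11 * (E ^ 11 * partGen) := by
    linear_combination (-E ^ 21) * partGen_mul_E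
  rw [h2, proj_pow_eleven_mul, proj_pow_eleven_mul] at h1
  have h3 := pow_ne_zero 11 E_ne_zero
  exact (mul_eq_zero.mp ((mul_eq_zero.mp h1).resolve_left h3)).resolve_left h3

end PartitionEleven

/-- For every natural number `n`, the number of partitions of `11 n + 6`
is divisible by `11`. -/
theorem partition_congruence_mod_eleven (n : ℕ) :
    11 ∣ Fintype.card (Nat.Partition (11 * n + 6)) := by
  have h := congrArg (PowerSeries.coeff (11 * n + 6)) PartitionEleven.proj_partGen
  rw [PartitionEleven.coeff_proj, if_pos, map_zero, PartitionEleven.partGen,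
    PowerSeries.coeff_mk] at h
  · exact (ZMod.natCast_eq_zero_iff _ _).mp h
  · have h11 : ((11 : ℕ) : PartitionEleven.K) = 0 := ZMod.natCast_self 11
    push_cast at h11 ⊢
    rw [h11]; ring
end
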